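/- For each policy π there exists a family of nonrandomized policies f̄(θ̄), parametrized by θ̄ ∈ [0,1]^∞, such that: (i) the map (p_0, θ̄) ↦ ρ_{p_0}[f̄(θ̄)] from P(𝕏) × [0,1]^∞ into P(Ω) is universally measurable; and (ii) for all p_0 ∈ P(𝕏) and all universally measurable E ⊂ Ω, P^π_{p_0}(E) = ∫_{[0,1]^∞} P^{f̄(θ̄)}_{p_0}(E) λ̄(dθ̄), where λ̄ is the countable product of Lebesgue measures on [0,1]. Moreover, if π is Markov (resp. semi-Markov), the policies f̄(θ̄) are Markov (resp. semi-Markov). -/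

import Mathlib

open MeasureTheory ProbabilityTheory Filter
open scoped ENNReal NNReal Topology

noncomputable section

namespace PaperStmt

/-- The Borel σ-algebra of the topology of weak convergence on the space of Borel
probability measures. -/
instance instMeasProb {Ω : Type*} [MeasurableSpace Ω] [TopologicalSpace Ω]
    [OpensMeasurableSpace Ω] : MeasurableSpace (ProbabilityMeasure Ω) := borel _

/-- A set is universally measurable if it is measurable with respect to the completion of
every Borel probability measure. -/
def UniversallyMeasurableSet {α : Type*} [MeasurableSpace α] (s : Set α) : Prop :=
  ∀ μ : Measure α, IsProbabilityMeasure μ → NullMeasurableSet s μ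

/-- A map between measurable spaces is universally measurable if preimages of measurable
sets are universally measurable. -/
def UniversallyMeasurable {α β : Type*} [MeasurableSpace α] [MeasurableSpace β]
    (f : α → β) : Prop :=
  ∀ s : Set β, MeasurableSet s → UniversallyMeasurableSet (f ⁻¹' s)

/-- A function into the extended reals is lower semianalytic if all its sublevel sets are
analytic. -/
def LowerSemianalytic {γ : Type*} [TopologicalSpace γ] (f : γ → EReal) : Prop :=
  ∀ r : ℝ, MeasureTheory.AnalyticSet {x | f x ≤ (r : EReal)}

/-- Lower semianalyticity on a given (analytic) domain. -/
def LowerSemianalyticOn {γ : Type*} [TopologicalSpace γ] (D : Set γ) (f : γ → EReal) : Prop :=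
  ∀ r : ℝ, MeasureTheory.AnalyticSet {x | x ∈ D ∧ f x ≤ (r : EReal)}

/-- Upper semianalyticity on a given (analytic) domain. -/
def UpperSemianalyticOn {γ : Type*} [TopologicalSpace γ] (D : Set γ) (f : γ → EReal) : Prop :=
  ∀ r : ℝ, MeasureTheory.AnalyticSet {x | x ∈ D ∧ (r : EReal) ≤ f x}

/-- The nonnegative part of an extended real number, as an element of `ℝ≥0∞`. -/
def ePos (y : EReal) : ℝ≥0∞ := if y = ⊤ then ⊤ else ENNReal.ofReal y.toReal

/-- The integral `∫ f⁺ dμ - ∫ f⁻ dμ` of an extended-real-valued function, with the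
convention `∞ - ∞ = ∞`. -/
def eint {γ : Type*} [MeasurableSpace γ] (μ : Measure γ) (f : γ → EReal) : EReal :=
  if (∫⁻ x, ePos (f x) ∂μ) = ⊤ then ⊤
  else ((∫⁻ x, ePos (f x) ∂μ : ℝ≥0∞) : EReal) - ((∫⁻ x, ePos (-f x) ∂μ : ℝ≥0∞) : EReal)

/-- Finite sums of extended reals, with the convention `∞ - ∞ = ∞`. -/
def esum {n : ℕ} (v : Fin n → EReal) : EReal :=
  if (∑ i, ePos (v i)) = ⊤ then ⊤
  else ((∑ i, ePos (v i) : ℝ≥0∞) : EReal) - ((∑ i, ePos (-v i) : ℝ≥0∞) : EReal)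

/-- The space `H_n = (𝕏 × 𝔸)ⁿ × 𝕏` of histories `h_n = (x_0,a_0,…,x_n)`. -/
abbrev Hist (X A : Type*) (n : ℕ) := (Fin n → X × A) × X

/-- The sample space `Ω = (𝕏 × 𝔸)^∞`. -/
abbrev Traj (X A : Type*) := ℕ → X × A

/-- The initial state `x_0` of a history. -/
def firstState {X A : Type*} : ∀ {n : ℕ}, Hist X A n → X
  | 0, h => h.2
  | _ + 1, h => (h.1 0).1

/-- A universally measurable policy for the MDP with control constraint `Acts`. -/
structure Policy {X A : Type*} [MeasurableSpace X] [MeasurableSpace A]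
    (Acts : X → Set A) where
  μ : ∀ n : ℕ, Hist X A n → Measure A
  isProb : ∀ n h, IsProbabilityMeasure (μ n h)
  umeas : ∀ (n : ℕ) (B : Set A), MeasurableSet B →
    UniversallyMeasurable fun h : Hist X A n => μ n h B
  feasible : ∀ n h, μ n h (Acts h.2) = 1

namespace Policy

variable {X A : Type*} [MeasurableSpace X] [MeasurableSpace A] {Acts : X → Set A}

/-- Nonrandomized policies: every decision is a Dirac measure. -/
def Nonrandomized (π : Policy Acts) : Prop :=
  ∀ n h, ∃ a : A, π.μ n h = Measure.dirac a

/-- Markov policies: the decision depends only on the current state. -/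
def Markov (π : Policy Acts) : Prop :=
  ∃ m : ℕ → X → Measure A, ∀ n h, π.μ n h = m n h.2

/-- Stationary policies. -/
def Stationary (π : Policy Acts) : Prop :=
  ∃ m : X → Measure A, ∀ n h, π.μ n h = m h.2

/-- Semi-Markov policies: the decision depends only on `(x_0, x_n)`. -/
def SemiMarkov (π : Policy Acts) : Prop :=
  ∃ m : ℕ → X × X → Measure A, ∀ n h, π.μ n h = m n (firstState h, h.2)

/-- Semi-stationary policies. -/
def SemiStationary (π : Policy Acts) : Prop :=
  ∃ m : X × X → Measure A, ∀ n h, π.μ n h = m (firstState h, h.2)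

end Policy

variable {X A : Type*} [MeasurableSpace X] [MeasurableSpace A]

/-- The iterated integral giving the finite-dimensional distributions of the process
induced by an initial distribution, the transition kernel and a policy. -/
def histInt (p0 : Measure X) (q : Kernel (X × A) X)
    (ν : ∀ n : ℕ, Hist X A n → Measure A) :
    ∀ n : ℕ, (Hist X A n → ℝ≥0∞) → ℝ≥0∞
  | 0, f => ∫⁻ x, f (Fin.elim0, x) ∂p0
  | n + 1, f => histInt p0 q ν n fun h =>
      ∫⁻ a, ∫⁻ y, f (Fin.snoc h.1 (h.2, a), y) ∂(q (h.2, a)) ∂(ν n h)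

/-- `Induces q π p0 p` says that `p` is (the restriction to the Borel σ-algebra of) the
strategic measure `ρ_{p0}[π]`, i.e. `p` has the finite-dimensional distributions generated
by `p0`, the policy `π`, and the transition kernel `q`. -/
def Induces (q : Kernel (X × A) X) {Acts : X → Set A} (π : Policy Acts)
    (p0 : Measure X) (p : Measure (Traj X A)) : Prop :=
  ∀ (n : ℕ) (B : Set (Hist X A n)), MeasurableSet B →
    p {ω : Traj X A | ((fun i : Fin n => ω i.val), (ω n).1) ∈ B}
      = histInt p0 q π.μ n (B.indicator fun _ => 1)

/-- The set of strategic measures induced by policies in the class `C` (over all initial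
distributions). -/
def SOf (q : Kernel (X × A) X) (Acts : X → Set A) (C : Policy Acts → Prop) :
    Set (ProbabilityMeasure (Traj X A)) :=
  {p | ∃ (π : Policy Acts) (p0 : ProbabilityMeasure X),
    C π ∧ Induces q π p0.toMeasure p.toMeasure}

variable [TopologicalSpace X] [BorelSpace X] [TopologicalSpace A] [BorelSpace A]

/-- The section `tilde-S_⋆(x)`: strategic measures in the class with initial distribution `δ_x`. -/
def tsec (q : Kernel (X × A) X) (Acts : X → Set A) (C : Policy Acts → Prop) (x : X) :
    Set (ProbabilityMeasure (Traj X A)) :=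
  {p | p ∈ SOf q Acts C ∧ p.toMeasure.map (fun ω => (ω 0).1) = Measure.dirac x}

/-- The set `tilde-S_⋆ ⊂ 𝕏 × P(Ω)`. -/
def tset (q : Kernel (X × A) X) (Acts : X → Set A) (C : Policy Acts → Prop) :
    Set (X × ProbabilityMeasure (Traj X A)) :=
  {xp | xp.2 ∈ tsec q Acts C xp.1}

end PaperStmt

namespace PaperStmt

section Universal

variable {α β γ : Type*} [MeasurableSpace α] [MeasurableSpace β] [MeasurableSpace γ]

/-- The σ-algebra of universally measurable sets. -/
@[reducible] def universalSpace (α : Type*) [MeasurableSpace α] : MeasurableSpace α where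
  MeasurableSet' s := UniversallyMeasurableSet s
  measurableSet_empty _ _ := MeasurableSet.empty.nullMeasurableSet
  measurableSet_compl _ hs μ hμ := (hs μ hμ).compl
  measurableSet_iUnion _ hs μ hμ := NullMeasurableSet.iUnion fun i => hs i μ hμ

lemma le_universalSpace : ‹MeasurableSpace α› ≤ universalSpace α :=
  fun _ hs _ _ => hs.nullMeasurableSet

lemma _root_.Measurable.universallyMeasurable {f : α → β} (hf : Measurable f) :
    UniversallyMeasurable f := fun _ hs => le_universalSpace _ (hf hs)

lemma universallyMeasurableSet_preimage_of_aemeasurable {f : α → β}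
    (hf : ∀ μ : Measure α, IsProbabilityMeasure μ → AEMeasurable f μ)
    {s : Set β} (hs : UniversallyMeasurableSet s) : UniversallyMeasurableSet (f ⁻¹' s) := by
  intro μ hμ
  have := Measure.isProbabilityMeasure_map (hf μ hμ)
  obtain ⟨t, -, ht, hts⟩ := (hs (μ.map f) this).exists_measurable_superset_ae_eq
  refine ((hf μ hμ).nullMeasurable ht).congr ?_
  filter_upwards [ae_of_ae_map (hf μ hμ) hts] with x hx using hx

lemma UniversallyMeasurable.aemeasurable [MeasurableSpace.CountablyGenerated β] {f : α → β}
    (hf : UniversallyMeasurable f) (μ : Measure α) [hμ : IsProbabilityMeasure μ] :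
    AEMeasurable f μ :=
  NullMeasurable.aemeasurable fun _ hs => hf _ hs μ hμ

lemma UniversallyMeasurable.preimage [MeasurableSpace.CountablyGenerated β] {f : α → β}
    (hf : UniversallyMeasurable f) {s : Set β} (hs : UniversallyMeasurableSet s) :
    UniversallyMeasurableSet (f ⁻¹' s) :=
  universallyMeasurableSet_preimage_of_aemeasurable (fun μ _ => hf.aemeasurable μ) hs

lemma UniversallyMeasurable.comp [MeasurableSpace.CountablyGenerated β] {g : β → γ} {f : α → β}
    (hg : UniversallyMeasurable g) (hf : UniversallyMeasurable f) :
    UniversallyMeasurable fun x => g (f x) :=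
  fun _ hs => hf.preimage (hg _ hs)

lemma UniversallyMeasurable.comp_measurable {g : β → γ} {f : α → β}
    (hg : UniversallyMeasurable g) (hf : Measurable f) :
    UniversallyMeasurable fun x => g (f x) :=
  fun _ hs => universallyMeasurableSet_preimage_of_aemeasurable
    (fun _ _ => hf.aemeasurable) (hg _ hs)

lemma _root_.Measurable.comp_universallyMeasurable {g : β → γ} {f : α → β}
    (hg : Measurable g) (hf : UniversallyMeasurable f) :
    UniversallyMeasurable fun x => g (f x) :=
  fun _ hs => hf _ (hg hs)

lemma UniversallyMeasurable.prodMk {f : α → β} {g : α → γ}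
    (hf : UniversallyMeasurable f) (hg : UniversallyMeasurable g) :
    UniversallyMeasurable fun x => (f x, g x) :=
  Measurable.prodMk (m := universalSpace α) hf hg

lemma universallyMeasurable_pi {ι : Type*} {E : ι → Type*} [∀ i, MeasurableSpace (E i)]
    {f : α → ∀ i, E i} (hf : ∀ i, UniversallyMeasurable fun x => f x i) :
    UniversallyMeasurable f :=
  @measurable_pi_lambda _ _ _ (universalSpace α) _ _ hf

/-- Integrating out a variable preserves universal measurability. -/
lemma UniversallyMeasurable.lintegral_prod_right {f : α × β → ℝ≥0∞}
    (hf : UniversallyMeasurable f) (ν : Measure β) [IsProbabilityMeasure ν] :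
    UniversallyMeasurable fun x => ∫⁻ y, f (x, y) ∂ν := by
  intro s hs μ hμ
  exact ((hf.aemeasurable (μ.prod ν)).lintegral_prod_right').nullMeasurable hs

end Universal

section Analytic

variable {Y : Type*} [TopologicalSpace Y] [T2Space Y]

/-- Sequences whose first `k` terms are bounded by those of `n`. -/
def boundedSeqs (n : ℕ → ℕ) (k : ℕ) : Set (ℕ → ℕ) := {σ | ∀ i < k, σ i ≤ n i}

lemma iInter_closure_image_boundedSeqs {g : (ℕ → ℕ) → Y} (hg : Continuous g)
    (n : ℕ → ℕ) :
    ⋂ k, closure (g '' boundedSeqs n k) ⊆ g '' Set.univ.pi fun i => Set.Iic (n i) := by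
  intro x hx
  have hK : IsCompact (Set.univ.pi fun i => Set.Iic (n i)) :=
    isCompact_univ_pi fun i => (Set.finite_Iic (n i)).isCompact
  by_contra hxK
  obtain ⟨U, V, hU, hV, hKU, hxV, hUV⟩ :=
    SeparatedNhds.of_isCompact_isCompact (hK.image hg) isCompact_singleton
      (Set.disjoint_singleton_right.2 hxK)
  have h1 : ∀ k, ∃ τ ∈ boundedSeqs n k, g τ ∈ V := by
    intro k
    obtain ⟨_, hyV, τ, hτ, rfl⟩ := mem_closure_iff.1 (Set.mem_iInter.1 hx k) V hV (hxV rfl)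
    exact ⟨τ, hτ, hyV⟩
  choose τ hτ hτV using h1
  let τ' : ℕ → ℕ → ℕ := fun k i => if i < k then τ k i else 0
  have hτ' : ∀ k, τ' k ∈ Set.univ.pi fun i => Set.Iic (n i) := by
    intro k i _
    by_cases h : i < k
    · simpa [τ', h] using hτ k i h
    · simp [τ', h]
  obtain ⟨σ, hσ, φ, hφ, hlim⟩ := hK.tendsto_subseq hτ'
  have hlim' : Tendsto (fun j => τ (φ j)) atTop (𝓝 σ) := by
    rw [tendsto_pi_nhds] at hlim ⊢
    intro i
    refine (hlim i).congr' ?_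
    filter_upwards [hφ.tendsto_atTop.eventually_gt_atTop i] with j hj
    simp [τ', hj]
  have h2 : ∀ᶠ j in atTop, g (τ (φ j)) ∈ U :=
    (hg.tendsto σ |>.comp hlim').eventually (hU.mem_nhds (hKU ⟨σ, hσ, rfl⟩))
  obtain ⟨j, hj⟩ := h2.exists
  exact Set.disjoint_left.1 hUV hj (hτV _)

variable [MeasurableSpace Y] [OpensMeasurableSpace Y]

/-- Analytic sets are inner regular with respect to compact sets. -/
lemma exists_isCompact_le_measure_of_lt_measure_range {g : (ℕ → ℕ) → Y} (hg : Continuous g)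
    (μ : Measure Y) [IsFiniteMeasure μ] {c : ℝ≥0∞} (hc : c < μ (Set.range g)) :
    ∃ K ⊆ Set.range g, IsCompact K ∧ c ≤ μ K := by
  have step : ∀ (k : ℕ) (S : Set (ℕ → ℕ)), c < μ (g '' S) →
      ∃ m, c < μ (g '' {σ ∈ S | σ k ≤ m}) := by
    intro k S hS
    have hmono : Monotone fun m : ℕ => g '' {σ ∈ S | σ k ≤ m} := fun a b hab =>
      Set.image_mono fun σ hσ => ⟨hσ.1, hσ.2.trans hab⟩
    have hU : g '' S = ⋃ m : ℕ, g '' {σ ∈ S | σ k ≤ m} := by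
      rw [← Set.image_iUnion]
      congr 1
      ext σ
      simpa using fun _ => ⟨σ k, le_rfl⟩
    rw [hU, hmono.measure_iUnion] at hS
    exact lt_iSup_iff.1 hS
  choose! m hm using step
  let S : ℕ → Set (ℕ → ℕ) := fun k =>
    Nat.rec Set.univ (fun k T => {σ ∈ T | σ k ≤ m k T}) k
  have hS : ∀ k, c < μ (g '' S k) := by
    intro k
    induction k with
    | zero => simpa [S] using hc
    | succ k ih => exact hm k _ ih
  have hSb : ∀ k, S k = boundedSeqs (fun i => m i (S i)) k := by
    intro k
    induction k with
    | zero => simp [S, boundedSeqs]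
    | succ k ih =>
      have hσ : ∀ σ, σ ∈ S k ↔ σ ∈ boundedSeqs (fun i => m i (S i)) k := by rw [← ih]; simp
      ext σ
      change σ ∈ S k ∧ σ k ≤ m k (S k) ↔ _
      rw [hσ]
      simp only [boundedSeqs, Set.mem_ofPred_eq, Nat.forall_lt_succ_right]
  set n : ℕ → ℕ := fun i => m i (S i) with hn
  have hK : IsCompact (g '' Set.univ.pi fun i => Set.Iic (n i)) :=
    (isCompact_univ_pi fun i => (Set.finite_Iic (n i)).isCompact).image hg
  refine ⟨_, Set.image_subset_range _ _, hK, ?_⟩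
  refine le_trans ?_ (measure_mono (iInter_closure_image_boundedSeqs hg n))
  have hanti : Antitone fun k => closure (g '' boundedSeqs n k) := fun a b hab =>
    closure_mono (Set.image_mono fun σ hσ i hi => hσ i (hi.trans_le hab))
  rw [hanti.measure_iInter (fun k => isClosed_closure.measurableSet.nullMeasurableSet)
    ⟨0, measure_ne_top _ _⟩]
  refine le_iInf fun k => ?_
  rw [← hSb]
  exact (hS k).le.trans (measure_mono subset_closure)

/-- Analytic sets are universally measurable. -/
lemma _root_.MeasureTheory.AnalyticSet.universallyMeasurableSet {s : Set Y}
    (hs : AnalyticSet s) : UniversallyMeasurableSet s := by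
  intro μ hμ
  rw [AnalyticSet] at hs
  obtain rfl | ⟨g, hg, rfl⟩ := hs
  · exact MeasurableSet.empty.nullMeasurableSet
  by_cases h0 : μ (Set.range g) = 0
  · exact NullMeasurableSet.of_null h0
  obtain ⟨c, -, hc, hclim⟩ := exists_seq_strictMono_tendsto' (pos_iff_ne_zero.2 h0)
  choose K hKs hK hcK using fun n =>
    exists_isCompact_le_measure_of_lt_measure_range hg μ (hc n).2
  have hL : NullMeasurableSet (⋃ n, K n) μ :=
    NullMeasurableSet.iUnion fun n => (hK n).isClosed.measurableSet.nullMeasurableSet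
  refine hL.congr (ae_eq_of_subset_of_measure_ge (Set.iUnion_subset hKs) ?_ hL
    (measure_ne_top _ _))
  exact le_of_tendsto' hclim fun n => (hcK n).trans (measure_mono (Set.subset_iUnion K n))

end Analytic

/-- Jankov–von Neumann uniformization: an analytic set with nonempty sections has a
universally measurable selector. -/
lemma exists_universallyMeasurable_selector
    {X A : Type*} [TopologicalSpace X] [PolishSpace X] [MeasurableSpace X] [BorelSpace X]
    [TopologicalSpace A] [PolishSpace A] [MeasurableSpace A] [BorelSpace A]
    {Γ : Set (X × A)} (hΓ : AnalyticSet Γ) (hne : ∀ x, ∃ a, (x, a) ∈ Γ) :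
    ∃ s : X → A, UniversallyMeasurable s ∧ ∀ x, (x, s x) ∈ Γ := by
  rcases isEmpty_or_nonempty X with hX | ⟨⟨x₀⟩⟩
  · exact ⟨hX.elim, fun _ _ _ _ => Set.Subsingleton.measurableSet
      (Set.subsingleton_of_subsingleton) |>.nullMeasurableSet, hX.elim⟩
  rw [AnalyticSet] at hΓ
  obtain rfl | ⟨g, hg, rfl⟩ := hΓ
  · exact absurd (hne x₀) (by simp)
  let D : ℕ → Set (X × (ℕ → ℕ)) := fun n => {z | ∃ σ, (∀ i < n, σ i = z.2 i) ∧ (g σ).1 = z.1}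
  have hD : ∀ n, UniversallyMeasurableSet (D n) := by
    intro n
    have hcl : IsClosed {w : (ℕ → ℕ) × (ℕ → ℕ) | ∀ i < n, w.1 i = w.2 i} := by
      simp only [Set.ofPred_forall]
      exact isClosed_iInter fun i => isClosed_iInter fun _ =>
        isClosed_eq (by fun_prop) (by fun_prop)
    have : D n = (fun w : (ℕ → ℕ) × (ℕ → ℕ) => ((g w.1).1, w.2)) ''
        {w | ∀ i < n, w.1 i = w.2 i} := by
      ext ⟨x, p⟩
      constructor
      · rintro ⟨σ, h, rfl⟩
        exact ⟨(σ, p), h, rfl⟩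
      · rintro ⟨⟨σ, p'⟩, h, heq⟩
        obtain ⟨rfl, rfl⟩ := Prod.mk.inj heq
        exact ⟨σ, h, rfl⟩
    rw [this]
    exact (hcl.measurableSet.analyticSet_image
      (Continuous.measurable (by fun_prop))).universallyMeasurableSet
  let P : ℕ → X → ℕ → ℕ := fun n x => Nat.rec (fun _ => 0) (fun n p =>
    Function.update p n (sInf {m | (x, Function.update p n m) ∈ D (n + 1)})) n
  have hP : ∀ n x, P (n + 1) x = Function.update (P n x) n
      (sInf {m | (x, Function.update (P n x) n m) ∈ D (n + 1)}) := fun _ _ => rfl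
  have hex : ∀ n x, (x, P n x) ∈ D n →
      ∃ m, (x, Function.update (P n x) n m) ∈ D (n + 1) := by
    rintro n x ⟨σ, h, hx⟩
    refine ⟨σ n, σ, fun i hi => ?_, hx⟩
    rcases Nat.lt_succ_iff_lt_or_eq.1 hi with h' | rfl
    · simp [h'.ne, h i h']
    · simp
  have hPD : ∀ n x, (x, P n x) ∈ D n := by
    intro n x
    induction n with
    | zero =>
      obtain ⟨a, σ, hσ⟩ := hne x
      exact ⟨σ, by simp, by rw [hσ]⟩
    | succ n ih =>
      rw [hP]
      exact Nat.sInf_mem (s := {m | (x, Function.update (P n x) n m) ∈ D (n + 1)}) (hex n x ih)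
  have hPm : ∀ n, UniversallyMeasurable (P n) := by
    intro n
    induction n with
    | zero => exact measurable_const.universallyMeasurable
    | succ n ih =>
      classical
      have hm : ∀ m, UniversallyMeasurable fun x => (x, Function.update (P n x) n m) := fun m =>
        measurable_id.universallyMeasurable.prodMk
          (Measurable.comp_universallyMeasurable (g := fun p => Function.update p n m)
            (measurable_update' (a := n) |>.comp (measurable_id.prodMk measurable_const)) ih)
      have hf : UniversallyMeasurable fun x =>
          sInf {m | (x, Function.update (P n x) n m) ∈ D (n + 1)} := by
        have h : (fun x => sInf {m | (x, Function.update (P n x) n m) ∈ D (n + 1)}) =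
            fun x => Nat.find (hex n x (hPD n x)) :=
          funext fun x => Nat.sInf_def (hex n x (hPD n x))
        rw [h]
        exact @measurable_find _ (universalSpace X) _ _ (fun x => hex n x (hPD n x))
          fun k => (hm k).preimage (hD (n + 1))
      exact Measurable.comp_universallyMeasurable (measurable_update' (a := n)) (ih.prodMk hf)
  have hstab : ∀ x i n, i < n → P n x i = P (i + 1) x i := by
    intro x i n hi
    induction n, hi using Nat.le_induction with
    | base => rfl
    | succ n hn ih =>
      rw [hP, Function.update_of_ne (by omega)]
      exact ih
  let σ : X → ℕ → ℕ := fun x i => P (i + 1) x i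
  have hσ : ∀ x, (g (σ x)).1 = x := by
    intro x
    choose τ hτ hτx using fun n => hPD n x
    have hlim : Tendsto τ atTop (𝓝 (σ x)) := by
      rw [tendsto_pi_nhds]
      intro i
      refine tendsto_const_nhds.congr' ?_
      filter_upwards [eventually_gt_atTop i] with n hn
      exact ((hτ n i hn).trans (hstab x i n hn)).symm
    refine tendsto_nhds_unique ((continuous_fst.comp hg).tendsto _ |>.comp hlim) ?_
    simp only [Function.comp_def, hτx]
    exact tendsto_const_nhds
  have hσm : UniversallyMeasurable σ := universallyMeasurable_pi fun i =>
    Measurable.comp_universallyMeasurable (f := P (i + 1)) (g := fun p : ℕ → ℕ => p i)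
      (measurable_pi_apply i) (hPm (i + 1))
  refine ⟨fun x => (g (σ x)).2, (continuous_snd.comp hg).measurable.comp_universallyMeasurable hσm,
    fun x => ⟨σ x, Prod.ext (hσ x) rfl⟩⟩

section WeakTopology

variable {Y : Type*} [TopologicalSpace Y] [MeasurableSpace Y] [BorelSpace Y]

lemma measurable_borel_apply [HasOuterApproxClosed Y] {B : Set Y} (hB : MeasurableSet B) :
    Measurable[borel (ProbabilityMeasure Y)] fun p : ProbabilityMeasure Y => p.toMeasure B := by
  let : MeasurableSpace (ProbabilityMeasure Y) := borel _
  have : BorelSpace (ProbabilityMeasure Y) := ⟨rfl⟩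
  have h : Measurable fun p : ProbabilityMeasure Y => p.toMeasure := by
    refine .measure_of_isPiSystem_of_isProbabilityMeasure (BorelSpace.measurable_eq (α := Y))
      isPiSystem_isOpen fun U hU => LowerSemicontinuous.measurable fun p => ?_
    intro c hc
    have := ProbabilityMeasure.le_liminf_measure_open_of_tendsto
      (tendsto_id (α := ProbabilityMeasure Y) (x := 𝓝 p)) hU
    exact eventually_lt_of_lt_liminf (hc.trans_le this)
  exact (Measure.measurable_coe hB).comp h

/-- A map into the space of probability measures is measurable for the Borel σ-algebra of the
weak topology as soon as all evaluations at open sets are. -/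
lemma measurable_borel_of_measurable_apply [SecondCountableTopology Y]
    {α : Type*} [MeasurableSpace α] {R : α → ProbabilityMeasure Y}
    (hR : ∀ U, IsOpen U → Measurable fun x => (R x).toMeasure U) :
    @Measurable _ _ _ (borel (ProbabilityMeasure Y)) R := by
  let b := TopologicalSpace.countableBasis Y
  let 𝒰 : Set (Set Y) := {U | ∃ F : Set (Set Y), F.Finite ∧ F ⊆ b ∧ U = ⋃₀ F}
  have h𝒰c : 𝒰.Countable := by
    refine ((Set.countable_ofPred_finite_subset
      (TopologicalSpace.countable_countableBasis Y)).image Set.sUnion).mono ?_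
    rintro _ ⟨F, hF, hFb, rfl⟩
    exact ⟨F, ⟨hF, hFb⟩, rfl⟩
  have h𝒰o : ∀ U ∈ 𝒰, IsOpen U := by
    rintro _ ⟨F, -, hF, rfl⟩
    exact isOpen_sUnion fun V hV => TopologicalSpace.isOpen_of_mem_countableBasis (hF hV)
  let S : Set (Set (ProbabilityMeasure Y)) :=
    (fun w : Set Y × ℚ => {p | ENNReal.ofReal w.2 < p.toMeasure w.1}) '' (𝒰 ×ˢ Set.univ)
  have hSc : S.Countable := (h𝒰c.prod Set.countable_univ).image _
  let t' : TopologicalSpace (ProbabilityMeasure Y) := .generateFrom S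
  have hsc : @SecondCountableTopology _ t' := ⟨⟨S, hSc, rfl⟩⟩
  have happrox : ∀ (p : ProbabilityMeasure Y) (G : Set Y), IsOpen G → ∀ c < p.toMeasure G,
      ∃ U ∈ 𝒰, U ⊆ G ∧ c < p.toMeasure U := by
    intro p G hG c hc
    obtain ⟨T, hTb, rfl⟩ := (TopologicalSpace.isBasis_countableBasis Y).open_eq_sUnion hG
    rcases T.eq_empty_or_nonempty with rfl | hT
    · simp at hc
    obtain ⟨f, rfl⟩ := ((TopologicalSpace.countable_countableBasis Y).mono hTb).exists_eq_range hT
    rw [Set.sUnion_range, measure_iUnion_eq_iSup_accumulate] at hc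
    obtain ⟨n, hn⟩ := lt_iSup_iff.1 hc
    refine ⟨Set.accumulate f n, ⟨f '' Set.Iic n, (Set.finite_Iic n).image f,
      (Set.image_subset_range _ _).trans hTb, ?_⟩, ?_, hn⟩
    · simp [Set.accumulate_def]
    · rw [Set.sUnion_range]
      exact Set.accumulate_subset_iUnion n
  have hle : t' ≤ ProbabilityMeasure.instTopologicalSpace := by
    refine le_of_nhds_le_nhds fun p => ?_
    have : (@nhds _ t' p).IsCountablyGenerated :=
      @FirstCountableTopology.nhds_generated_countable _ t' _ p
    refine tendsto_of_forall_isOpen_le_liminf' (μs := id) fun G hG =>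
      le_of_forall_lt_imp_le_of_dense fun c hc => ?_
    obtain ⟨U, hU, hUG, hcU⟩ := happrox p G hG c hc
    obtain ⟨r, -, hcr, hrU⟩ := ENNReal.lt_iff_exists_rat_btwn.1 hcU
    refine le_liminf_of_le (by isBoundedDefault) ?_
    have hopen : IsOpen[t'] {p' : ProbabilityMeasure Y | ENNReal.ofReal r < p'.toMeasure U} :=
      TopologicalSpace.isOpen_generateFrom_of_mem ⟨(U, r), ⟨hU, trivial⟩, rfl⟩
    filter_upwards [@IsOpen.mem_nhds _ t' p _ hopen hrU] with p' hp'
    exact hcr.le.trans (hp'.le.trans (measure_mono hUG))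
  have hb : @borel (ProbabilityMeasure Y) ProbabilityMeasure.instTopologicalSpace ≤
      .generateFrom S := by
    rw [← @borel_eq_generateFrom_of_subbasis _ S t' hsc rfl]
    exact borel_anti hle
  refine Measurable.mono (mb := .generateFrom S) ?_ le_rfl hb
  refine measurable_generateFrom ?_
  rintro _ ⟨⟨U, r⟩, ⟨hU, -⟩, rfl⟩
  exact measurableSet_lt measurable_const (hR U (h𝒰o U hU))

end WeakTopology

section ProductMeasure

open Measure

lemma eq_infinitePi_volume {lam : Measure (ℕ → unitInterval)}
    (hlam : ∀ (n : ℕ) (B : Fin n → Set unitInterval), (∀ i, MeasurableSet (B i)) →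
      lam {θ | ∀ i : Fin n, θ i.val ∈ B i} = ∏ i : Fin n, volume (Subtype.val '' B i)) :
    lam = infinitePi fun _ : ℕ => (volume : Measure unitInterval) := by
  classical
  refine eq_infinitePi _ fun s t ht => ?_
  let B : ℕ → Set unitInterval := fun i => if i ∈ s then t i else Set.univ
  have hB : ∀ i, MeasurableSet (B i) := fun i => by
    by_cases hi : i ∈ s <;> simp [B, hi, ht i]
  have hlt : ∀ i ∈ s, i < s.sup id + 1 := fun i hi => Nat.lt_succ_of_le (Finset.le_sup (f := id) hi)
  have hset : Set.pi (s : Set ℕ) t = {θ | ∀ i : Fin (s.sup id + 1), θ i.val ∈ B i.val} := by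
    ext θ
    constructor
    · intro h i
      by_cases hi : i.val ∈ s
      · simpa [B, hi] using h _ hi
      · simp [B, hi]
    · intro h i hi
      have := h ⟨i, hlt i hi⟩
      simpa [B, Finset.mem_coe.1 hi] using this
  rw [hset, hlam _ _ fun i => hB i.val]
  have hvol : ∀ C : Set unitInterval, volume (Subtype.val '' C) = volume C := fun C => by
    rw [Measure.Subtype.volume_def, comap_subtype_coe_apply measurableSet_Icc]
  simp_rw [hvol]
  rw [Fin.prod_univ_eq_prod_range (fun i => volume (B i)) (s.sup id + 1)]
  rw [← Finset.prod_subset (fun i hi => Finset.mem_range.2 (hlt i hi))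
    fun i _ hi => by simp [B, hi]]
  exact Finset.prod_congr rfl fun i hi => by simp [B, hi]

variable {E : Type*} [MeasurableSpace E] (ν : ℕ → Measure E) [∀ i, IsProbabilityMeasure (ν i)]

lemma map_update_infinitePi (n : ℕ) :
    ((infinitePi ν).prod (ν n)).map (fun z => Function.update z.1 n z.2) = infinitePi ν := by
  classical
  refine eq_infinitePi _ fun s t ht => ?_
  rw [Measure.map_apply measurable_update'
    (MeasurableSet.pi s.countable_toSet fun i _ => ht i)]
  have : (fun z : (ℕ → E) × E => Function.update z.1 n z.2) ⁻¹' Set.pi (s : Set ℕ) t =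
      Set.pi (s.erase n : Finset ℕ) t ×ˢ (if n ∈ s then t n else Set.univ) := by
    ext ⟨z, e⟩
    simp only [Set.mem_preimage, Set.mem_pi, Set.mem_prod, Finset.mem_coe, Finset.mem_erase]
    constructor
    · intro h
      refine ⟨fun i hi => by simpa [hi.1] using h i hi.2, ?_⟩
      split_ifs with hn
      · simpa using h n hn
      · trivial
    · rintro ⟨h1, h2⟩ i hi
      rcases eq_or_ne i n with rfl | hin
      · simpa [hi] using h2
      · simpa [hin] using h1 i ⟨hin, hi⟩
  rw [this, prod_prod, infinitePi_pi _ fun i _ => ht i]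
  split_ifs with hn
  · exact Finset.prod_erase_mul s _ hn
  · simp [hn]

/-- Under a product measure, a coordinate that does not influence the rest of the integrand
can be integrated out independently. -/
lemma lintegral_infinitePi_resample {n : ℕ} {F : (ℕ → E) × E → ℝ≥0∞}
    (hF : UniversallyMeasurable F) [MeasurableSpace.CountablyGenerated E]
    (hdep : ∀ z e e', F (Function.update z n e, e') = F (z, e')) :
    ∫⁻ z, F (z, z n) ∂infinitePi ν = ∫⁻ z, ∫⁻ e, F (z, e) ∂ν n ∂infinitePi ν := by
  have hm : Measurable fun z : (ℕ → E) × E => Function.update z.1 n z.2 := measurable_update'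
  have hG : UniversallyMeasurable fun z : ℕ → E => F (z, z n) :=
    hF.comp_measurable (measurable_id.prodMk (measurable_pi_apply n))
  rw [← lintegral_prod _ (hF.aemeasurable _)]
  conv_lhs => rw [← map_update_infinitePi ν n]
  have := isProbabilityMeasure_map (μ := (infinitePi ν).prod (ν n)) hm.aemeasurable
  rw [lintegral_map' (hG.aemeasurable _) hm.aemeasurable]
  exact lintegral_congr fun z => by simp [hdep]

end ProductMeasure

section Simulation

variable {X A : Type*}

/-- The history up to time `n` generated by the initial state `x`, decision functions `f`,
transition function `G`, decision randomness `θ` and transition randomness `η`. -/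
def simHist (f : ∀ n, Hist X A n → unitInterval → A) (G : X × A → unitInterval → X) (x : X)
    (θ η : ℕ → unitInterval) : ∀ n, Hist X A n
  | 0 => (Fin.elim0, x)
  | n + 1 =>
    (Fin.snoc (simHist f G x θ η n).1
      ((simHist f G x θ η n).2, f n (simHist f G x θ η n) (θ n)),
      G ((simHist f G x θ η n).2, f n (simHist f G x θ η n) (θ n)) (η (n + 1)))

/-- The trajectory whose histories are given by `simHist`. -/
def simTraj (f : ∀ n, Hist X A n → unitInterval → A) (G : X × A → unitInterval → X) (x : X)
    (θ η : ℕ → unitInterval) : Traj X A :=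
  fun n => ((simHist f G x θ η n).2, f n (simHist f G x θ η n) (θ n))

/-- The first `n` stages of a trajectory, followed by its state at time `n`. -/
def trajHist (n : ℕ) (ω : Traj X A) : Hist X A n := (fun i : Fin n => ω i.val, (ω n).1)

lemma trajHist_simTraj (f : ∀ n, Hist X A n → unitInterval → A) (G : X × A → unitInterval → X)
    (x : X) (θ η : ℕ → unitInterval) (n : ℕ) :
    trajHist n (simTraj f G x θ η) = simHist f G x θ η n := by
  refine Prod.ext ?_ rfl
  induction n with
  | zero => exact Subsingleton.elim _ _
  | succ n ih =>
    funext i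
    refine Fin.lastCases ?_ (fun j => ?_) i
    · simp [simHist, trajHist, simTraj]
    · simpa [simHist, trajHist] using congrFun ih j

lemma simHist_congr (f : ∀ n, Hist X A n → unitInterval → A) (G : X × A → unitInterval → X)
    (x : X) {θ θ' η η' : ℕ → unitInterval} {n : ℕ} (hθ : ∀ i < n, θ i = θ' i)
    (hη : ∀ i < n, η (i + 1) = η' (i + 1)) :
    simHist f G x θ η n = simHist f G x θ' η' n := by
  induction n with
  | zero => rfl
  | succ n ih =>
    simp only [simHist]
    rw [ih (fun i hi => hθ i (hi.trans n.lt_succ_self)) fun i hi => hη i (hi.trans n.lt_succ_self),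
      hθ n n.lt_succ_self, hη n n.lt_succ_self]

variable [MeasurableSpace X] [MeasurableSpace A]

lemma measurable_trajHist (n : ℕ) : Measurable (trajHist (X := X) (A := A) n) :=
  (measurable_pi_lambda _ fun _ => measurable_pi_apply _).prodMk
    (measurable_fst.comp (measurable_pi_apply n))

lemma measurable_snoc {E : Type*} [MeasurableSpace E] {n : ℕ} :
    Measurable fun z : (Fin n → E) × E => (Fin.snoc z.1 z.2 : Fin (n + 1) → E) := by
  refine measurable_pi_lambda _ fun i => ?_
  refine Fin.lastCases ?_ (fun j => ?_) i
  · simpa using measurable_snd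
  · simpa [Function.comp_def] using (measurable_pi_apply j).comp measurable_fst

variable [StandardBorelSpace X] [StandardBorelSpace A]

section Measurability

variable {f : ∀ n, Hist X A n → unitInterval → A}
  (hf : ∀ n, UniversallyMeasurable (Function.uncurry (f n)))
  {G : X × A → unitInterval → X} (hG : Measurable (Function.uncurry G))
include hf hG

lemma universallyMeasurable_step {Z : Type*} [MeasurableSpace Z] {n : ℕ} {h : Z → Hist X A n}
    {t e : Z → unitInterval} (hh : UniversallyMeasurable h) (ht : UniversallyMeasurable t)
    (he : UniversallyMeasurable e) :
    UniversallyMeasurable fun z => ((Fin.snoc (h z).1 ((h z).2, f n (h z) (t z)),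
      G ((h z).2, f n (h z) (t z)) (e z)) : Hist X A (n + 1)) := by
  have ha : UniversallyMeasurable fun z => f n (h z) (t z) := (hf n).comp (hh.prodMk ht)
  have hxa : UniversallyMeasurable fun z => ((h z).2, f n (h z) (t z)) :=
    (measurable_snd.comp_universallyMeasurable hh).prodMk ha
  exact (measurable_snoc.comp_universallyMeasurable
    ((measurable_fst.comp_universallyMeasurable hh).prodMk hxa)).prodMk
    (hG.comp_universallyMeasurable (hxa.prodMk he))

lemma universallyMeasurable_simHist {Z : Type*} [MeasurableSpace Z] {x : Z → X}
    {θ η : Z → ℕ → unitInterval} (hx : UniversallyMeasurable x) (hθ : Measurable θ)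
    (hη : Measurable η) (n : ℕ) :
    UniversallyMeasurable fun z => simHist f G (x z) (θ z) (η z) n := by
  induction n with
  | zero => exact (measurable_const (a := Fin.elim0)).universallyMeasurable.prodMk hx
  | succ n ih =>
    exact universallyMeasurable_step hf hG ih
      (((measurable_pi_apply n).comp hθ).universallyMeasurable)
      (((measurable_pi_apply (n + 1)).comp hη).universallyMeasurable)

lemma universallyMeasurable_simTraj {Z : Type*} [MeasurableSpace Z] {x : Z → X}
    {θ η : Z → ℕ → unitInterval} (hx : UniversallyMeasurable x) (hθ : Measurable θ)
    (hη : Measurable η) :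
    UniversallyMeasurable fun z => simTraj f G (x z) (θ z) (η z) := by
  refine universallyMeasurable_pi fun n => ?_
  have hh := universallyMeasurable_simHist hf hG hx hθ hη n
  exact (measurable_snd.comp_universallyMeasurable hh).prodMk
    ((hf n).comp (hh.prodMk (((measurable_pi_apply n).comp hθ).universallyMeasurable)))

end Measurability

end Simulation

open Measure

section Law

variable {X A : Type*} [MeasurableSpace X] [MeasurableSpace A]
  [StandardBorelSpace X] [StandardBorelSpace A]
  {f : ∀ n, Hist X A n → unitInterval → A}
  (hf : ∀ n, UniversallyMeasurable (Function.uncurry (f n)))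
  {G : X × A → unitInterval → X} (hG : Measurable (Function.uncurry G))
  {φ : unitInterval → X} (hφ : Measurable φ)

/-- The countable product of Lebesgue measures on `[0,1]`. -/
abbrev cubeMeasure : Measure (ℕ → unitInterval) := infinitePi fun _ => volume

/-- The expectation of a function of the next history given the current history `z.1`
and the decision randomness `z.2`. -/
def stepInt (f : ∀ n, Hist X A n → unitInterval → A) (G : X × A → unitInterval → X) {n : ℕ}
    (g : Hist X A (n + 1) → ℝ≥0∞) (z : Hist X A n × unitInterval) : ℝ≥0∞ :=
  ∫⁻ e, g (Fin.snoc z.1.1 (z.1.2, f n z.1 z.2), G (z.1.2, f n z.1 z.2) e)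

include hf hG

lemma universallyMeasurable_stepInt {n : ℕ} {g : Hist X A (n + 1) → ℝ≥0∞}
    (hg : UniversallyMeasurable g) : UniversallyMeasurable (stepInt f G g) := by
  refine UniversallyMeasurable.lintegral_prod_right (f := fun w : (Hist X A n × unitInterval) ×
    unitInterval => g (Fin.snoc w.1.1.1 (w.1.1.2, f n w.1.1 w.1.2),
      G (w.1.1.2, f n w.1.1 w.1.2) w.2)) ?_ volume
  exact hg.comp (universallyMeasurable_step hf hG
    (h := fun w : (Hist X A n × unitInterval) × unitInterval => w.1.1)
    (t := fun w => w.1.2) (e := fun w => w.2) (Measurable.universallyMeasurable (by fun_prop))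
    (Measurable.universallyMeasurable (by fun_prop))
    (Measurable.universallyMeasurable (by fun_prop)))

include hφ

lemma lintegral_simHist_succ (θ : ℕ → unitInterval) {n : ℕ} {g : Hist X A (n + 1) → ℝ≥0∞}
    (hg : UniversallyMeasurable g) :
    ∫⁻ η, g (simHist f G (φ (η 0)) θ η (n + 1)) ∂cubeMeasure =
      ∫⁻ η, stepInt f G g (simHist f G (φ (η 0)) θ η n, θ n) ∂cubeMeasure := by
  have hh : UniversallyMeasurable fun z : (ℕ → unitInterval) × unitInterval =>
      simHist f G (φ (z.1 0)) θ z.1 n :=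
    universallyMeasurable_simHist hf hG
      (Measurable.universallyMeasurable (by fun_prop)) measurable_const measurable_fst n
  refine lintegral_infinitePi_resample (n := n + 1) (fun _ => (volume : Measure unitInterval))
    (F := fun z => g (Fin.snoc (simHist f G (φ (z.1 0)) θ z.1 n).1
      ((simHist f G (φ (z.1 0)) θ z.1 n).2, f n (simHist f G (φ (z.1 0)) θ z.1 n) (θ n)),
      G ((simHist f G (φ (z.1 0)) θ z.1 n).2, f n (simHist f G (φ (z.1 0)) θ z.1 n) (θ n)) z.2))
    (hg.comp (universallyMeasurable_step hf hG hh measurable_const.universallyMeasurable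
      measurable_snd.universallyMeasurable)) fun η e e' => ?_
  have : simHist f G (φ (Function.update η (n + 1) e 0)) θ (Function.update η (n + 1) e) n =
      simHist f G (φ (η 0)) θ η n := by
    rw [Function.update_of_ne (by omega)]
    exact simHist_congr f G _ (fun _ _ => rfl) fun i hi => Function.update_of_ne (by omega) _ _
  simp only [this]

omit [StandardBorelSpace X] [StandardBorelSpace A] hf hG in
lemma lintegral_initial {p0 : Measure X} (hp0 : volume.map φ = p0)
    {g : Hist X A 0 → ℝ≥0∞} (hg : UniversallyMeasurable g) (θ : ℕ → unitInterval) :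
    ∫⁻ η, g (simHist f G (φ (η 0)) θ η 0) ∂cubeMeasure = ∫⁻ x, g (Fin.elim0, x) ∂p0 := by
  have := isProbabilityMeasure_map (μ := (volume : Measure unitInterval)) hφ.aemeasurable
  have hg' : UniversallyMeasurable fun x => g (Fin.elim0, x) :=
    hg.comp_measurable (measurable_const.prodMk measurable_id)
  rw [← hp0, lintegral_map' (hg'.aemeasurable _) hφ.aemeasurable,
    ← infinitePi_map_eval (fun _ : ℕ => (volume : Measure unitInterval)) 0]
  have := isProbabilityMeasure_map (μ := cubeMeasure)
    (measurable_pi_apply (X := fun _ : ℕ => unitInterval) 0).aemeasurable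
  rw [lintegral_map' ((hg'.comp_measurable hφ).aemeasurable _)
    (measurable_pi_apply 0).aemeasurable]
  rfl

omit hφ

variable {q : Kernel (X × A) X} (hGq : ∀ xa, volume.map (G xa) = q xa)
include hGq

omit [StandardBorelSpace X] [StandardBorelSpace A] hf in
lemma lintegral_transition {n : ℕ} {g : Hist X A (n + 1) → ℝ≥0∞} (hg : UniversallyMeasurable g)
    (h : Hist X A n) (a : A) :
    ∫⁻ y, g (Fin.snoc h.1 (h.2, a), y) ∂q (h.2, a) =
      ∫⁻ e, g (Fin.snoc h.1 (h.2, a), G (h.2, a) e) := by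
  have hG' : Measurable (G (h.2, a)) := hG.of_uncurry_left
  have := isProbabilityMeasure_map (μ := (volume : Measure unitInterval)) hG'.aemeasurable
  rw [← hGq, lintegral_map' _ hG'.aemeasurable]
  exact (hg.comp_measurable (measurable_const.prodMk measurable_id)).aemeasurable _

include hφ

/-- For fixed decision randomness, the simulated histories have the law induced by the
nonrandomized decision rules. -/
lemma lintegral_simHist_dirac {p0 : Measure X} (hp0 : volume.map φ = p0) (θ : ℕ → unitInterval)
    (n : ℕ) {g : Hist X A n → ℝ≥0∞} (hg : UniversallyMeasurable g) [MeasurableSingletonClass A] :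
    ∫⁻ η, g (simHist f G (φ (η 0)) θ η n) ∂cubeMeasure =
      histInt p0 q (fun n h => dirac (f n h (θ n))) n g := by
  induction n with
  | zero => exact lintegral_initial hφ hp0 hg θ
  | succ n ih =>
    rw [lintegral_simHist_succ hf hG hφ θ hg]
    refine (ih (g := fun h => stepInt f G g (h, θ n))
      ((universallyMeasurable_stepInt hf hG hg).comp_measurable
        (measurable_id.prodMk measurable_const))).trans ?_
    change _ = histInt p0 q _ n fun h => _
    congr 1
    funext h
    rw [lintegral_dirac, lintegral_transition hG hGq hg]
    rfl

/-- With uniform decision randomness, the simulated histories have the law induced by the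
decision rules represented by `f`. -/
lemma lintegral_simHist_map {p0 : Measure X} (hp0 : volume.map φ = p0)
    {ν : ∀ n, Hist X A n → Measure A} (hfν : ∀ n h, volume.map (f n h) = ν n h)
    (n : ℕ) {g : Hist X A n → ℝ≥0∞} (hg : UniversallyMeasurable g) :
    ∫⁻ θ, ∫⁻ η, g (simHist f G (φ (η 0)) θ η n) ∂cubeMeasure ∂cubeMeasure =
      histInt p0 q ν n g := by
  induction n with
  | zero => simp_rw [lintegral_initial hφ hp0 hg]; simp [histInt]
  | succ n ih =>
    have hk := universallyMeasurable_stepInt hf hG hg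
    have hh : UniversallyMeasurable fun z : ((ℕ → unitInterval) × unitInterval) ×
        (ℕ → unitInterval) => (simHist f G (φ (z.2 0)) z.1.1 z.2 n, z.1.2) :=
      (universallyMeasurable_simHist hf hG
        (Measurable.universallyMeasurable (by fun_prop)) (by fun_prop) (by fun_prop) n).prodMk
        (Measurable.universallyMeasurable (by fun_prop))
    have hK : UniversallyMeasurable fun h : Hist X A n => ∫⁻ t, stepInt f G g (h, t) :=
      hk.lintegral_prod_right volume
    have hhist : histInt p0 q ν (n + 1) g =
        histInt p0 q ν n fun h => ∫⁻ t, stepInt f G g (h, t) := by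
      change histInt p0 q _ n (fun h => _) = _
      congr 1
      funext h
      have hfh : UniversallyMeasurable (f n h) :=
        (hf n).comp_measurable (measurable_const.prodMk measurable_id)
      have hψ : UniversallyMeasurable fun a =>
          ∫⁻ e, g (Fin.snoc h.1 (h.2, a), G (h.2, a) e) := by
        refine UniversallyMeasurable.lintegral_prod_right (f := fun z : A × unitInterval =>
          g (Fin.snoc h.1 (h.2, z.1), G (h.2, z.1) z.2)) (hg.comp_measurable ?_) volume
        have hxa : Measurable fun z : A × unitInterval => (h.2, z.1) := by fun_prop
        exact (measurable_snoc.comp (measurable_const.prodMk hxa)).prodMk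
          (hG.comp (hxa.prodMk measurable_snd))
      have := isProbabilityMeasure_map (μ := (volume : Measure unitInterval))
        (hfh.aemeasurable volume)
      simp_rw [lintegral_transition hG hGq hg]
      rw [← hfν, lintegral_map' (hψ.aemeasurable _) (hfh.aemeasurable _)]
      rfl
    rw [hhist, ← ih hK]
    simp_rw [lintegral_simHist_succ hf hG hφ _ hg]
    refine (lintegral_infinitePi_resample (n := n) (fun _ => (volume : Measure unitInterval))
      (F := fun z => ∫⁻ η, stepInt f G g (simHist f G (φ (η 0)) z.1 η n, z.2) ∂cubeMeasure)
      ((hk.comp hh).lintegral_prod_right _) fun θ e e' => ?_).trans ?_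
    · refine lintegral_congr fun η => ?_
      dsimp only
      rw [simHist_congr f G _ (fun i hi => Function.update_of_ne hi.ne _ _) fun _ _ => rfl]
    · refine lintegral_congr fun θ => ?_
      refine lintegral_lintegral_swap (μ := (volume : Measure unitInterval))
        (ν := cubeMeasure) (f := fun t η => stepInt f G g (simHist f G (φ (η 0)) θ η n, t)) ?_
      exact ((hk.comp hh).comp_measurable (f := fun z : unitInterval × (ℕ → unitInterval) =>
        ((θ, z.1), z.2)) (by fun_prop)).aemeasurable _

end Law

section Histories

variable {X A : Type*} [MeasurableSpace X] [MeasurableSpace A]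

lemma measurable_firstState (n : ℕ) : Measurable (firstState : Hist X A n → X) := by
  cases n with
  | zero => exact measurable_snd
  | succ n => exact measurable_fst.comp ((measurable_pi_apply 0).comp measurable_fst)

/-- Laws of trajectories are determined by the laws of the histories. -/
lemma ext_of_trajHist {p p' : Measure (Traj X A)} [IsProbabilityMeasure p]
    [IsProbabilityMeasure p']
    (h : ∀ (n : ℕ) (B : Set (Hist X A n)), MeasurableSet B →
      p (trajHist n ⁻¹' B) = p' (trajHist n ⁻¹' B)) : p = p' := by
  let C : Set (Set (Traj X A)) :=
    {E | ∃ (n : ℕ) (B : Set (Fin n → X × A)), MeasurableSet B ∧ E = (fun ω i => ω i.val) ⁻¹' B}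
  have hext : ∀ (n m : ℕ), n ≤ m → ∀ B : Set (Fin n → X × A), MeasurableSet B →
      ∃ B' : Set (Fin m → X × A), MeasurableSet B' ∧
        (fun (ω : Traj X A) (i : Fin n) => ω i.val) ⁻¹' B = (fun ω i => ω i.val) ⁻¹' B' :=
    fun n m hnm B hB => ⟨(fun v i => v (Fin.castLE hnm i)) ⁻¹' B,
      (measurable_pi_lambda _ fun i => measurable_pi_apply _) hB, rfl⟩
  refine ext_of_generate_finite C ?_ ?_ ?_ (by simp)
  · refine le_antisymm (iSup_le fun i => ?_) (MeasurableSpace.generateFrom_le ?_)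
    · rintro _ ⟨B, hB, rfl⟩
      exact MeasurableSpace.measurableSet_generateFrom
        ⟨i + 1, (fun v => v (Fin.last i)) ⁻¹' B, measurable_pi_apply _ hB, rfl⟩
    · rintro _ ⟨n, B, hB, rfl⟩
      exact (measurable_pi_lambda _ fun i => measurable_pi_apply _) hB
  · rintro _ ⟨n, B, hB, rfl⟩ _ ⟨m, B', hB', rfl⟩ -
    obtain ⟨D, hD, h1⟩ := hext n (max n m) (le_max_left _ _) B hB
    obtain ⟨D', hD', h2⟩ := hext m (max n m) (le_max_right _ _) B' hB'
    exact ⟨max n m, D ∩ D', hD.inter hD', by rw [h1, h2]; rfl⟩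
  · rintro _ ⟨n, B, hB, rfl⟩
    exact h n (Prod.fst ⁻¹' B) (measurable_fst hB)

/-- Histories can be replaced measurably by representatives that depend only on the information
used by the policy. -/
lemma Policy.exists_reduction [Nonempty X] [Nonempty A] {Acts : X → Set A}
    (π : Policy Acts) :
    ∃ r : ∀ n, Hist X A n → Hist X A n, (∀ n, Measurable (r n)) ∧ (∀ n h, (r n h).2 = h.2) ∧
      (∀ n h, π.μ n (r n h) = π.μ n h) ∧
      (π.Markov → ∀ n h h', h.2 = h'.2 → r n h = r n h') ∧
      (π.SemiMarkov → ∀ n h h', firstState h = firstState h' → h.2 = h'.2 → r n h = r n h') := by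
  obtain ⟨x₀⟩ := ‹Nonempty X›
  obtain ⟨a₀⟩ := ‹Nonempty A›
  by_cases hM : π.Markov
  · refine ⟨fun n h => (fun _ => (x₀, a₀), h.2), fun n => by fun_prop, fun _ _ => rfl,
      fun n h => ?_, fun _ n h h' hh => by simp only [hh], fun _ n h h' _ hh => by simp only [hh]⟩
    obtain ⟨m, hm⟩ := hM
    rw [hm, hm]
  by_cases hS : π.SemiMarkov
  · have hfirst : ∀ n (h : Hist X A n),
        firstState ((fun _ => (firstState h, a₀), h.2) : Hist X A n) = firstState h := by
      intro n h
      cases n <;> rfl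
    refine ⟨fun n h => (fun _ => (firstState h, a₀), h.2), fun n => ?_, fun _ _ => rfl,
      fun n h => ?_, fun h => absurd h hM, fun _ n h h' h1 h2 => by simp only [h1, h2]⟩
    · have := measurable_firstState (X := X) (A := A) n
      exact (measurable_pi_lambda _ fun _ => this.prodMk measurable_const).prodMk measurable_snd
    · obtain ⟨m, hm⟩ := hS
      rw [hm, hm, hfirst]
  · exact ⟨fun n h => h, fun n => measurable_id, fun _ _ => rfl, fun _ _ => rfl,
      fun h => absurd h hM, fun h => absurd h hS⟩

end Histories

section Representation

variable {X A : Type*} [TopologicalSpace X] [PolishSpace X] [MeasurableSpace X] [BorelSpace X]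
  [TopologicalSpace A] [PolishSpace A] [MeasurableSpace A] [BorelSpace A] {Acts : X → Set A}

lemma exists_universallyMeasurable_map_eq {H : Type*} [MeasurableSpace H] [Nonempty A]
    {κ : H → Measure A} (hκ : ∀ h, IsProbabilityMeasure (κ h))
    (hκm : ∀ B, MeasurableSet B → UniversallyMeasurable fun h => κ h B) :
    ∃ f : H → unitInterval → A, UniversallyMeasurable (Function.uncurry f) ∧
      ∀ h, volume.map (f h) = κ h := by
  let K : @Kernel H A (universalSpace H) _ := @Kernel.mk H A (universalSpace H) _ κ
    (@Measure.measurable_of_measurable_coe _ _ _ (universalSpace H) κ hκm)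
  have hK : @IsMarkovKernel H A (universalSpace H) _ K := @IsMarkovKernel.mk _ _ (_) _ _ hκ
  obtain ⟨f, hf, hfK⟩ :=
    @Kernel.exists_measurable_map_eq_unitInterval H A (universalSpace H) _ _ _ K hK
  refine ⟨f, ?_, hfK⟩
  refine @Measurable.comp _ _ _ (universalSpace (H × unitInterval))
    (@Prod.instMeasurableSpace _ _ (universalSpace H) _) _ _ id hf ?_
  refine @Measurable.prodMk _ (universalSpace (H × unitInterval)) _ _ (universalSpace H) _
    _ _ ?_ measurable_snd.universallyMeasurable
  exact fun s hs => universallyMeasurableSet_preimage_of_aemeasurable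
    (fun _ _ => measurable_fst.aemeasurable) hs

/-- The randomized decision rules of a policy are images of Lebesgue measure on `[0,1]` under
universally measurable feasible decision functions. -/
lemma Policy.exists_representation [Nonempty A] (π : Policy Acts) (hne : ∀ x, (Acts x).Nonempty)
    (hΓ : AnalyticSet {xa : X × A | xa.2 ∈ Acts xa.1}) (n : ℕ) :
    ∃ f : Hist X A n → unitInterval → A, UniversallyMeasurable (Function.uncurry f) ∧
      (∀ h, volume.map (f h) = π.μ n h) ∧ ∀ h t, f h t ∈ Acts h.2 := by
  classical
  obtain ⟨s, hs, hsΓ⟩ := exists_universallyMeasurable_selector hΓ hne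
  obtain ⟨f, hf, hfπ⟩ := exists_universallyMeasurable_map_eq (π.isProb n) (π.umeas n)
  have hact : ∀ x, UniversallyMeasurableSet (Acts x) := fun x =>
    universallyMeasurableSet_preimage_of_aemeasurable (f := fun a => (x, a))
      (fun _ _ => measurable_prodMk_left.aemeasurable) hΓ.universallyMeasurableSet
  have hst : Measurable fun z : Hist X A n × unitInterval => z.1.2 := by fun_prop
  refine ⟨fun h t => if f h t ∈ Acts h.2 then f h t else s h.2, ?_, fun h => ?_, fun h t => ?_⟩
  · refine @Measurable.ite _ _ _ _ (universalSpace (Hist X A n × unitInterval)) _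
      (fun z => f z.1 z.2 ∈ Acts z.1.2) _ ?_ hf (hs.comp_measurable hst)
    exact (hst.universallyMeasurable.prodMk hf).preimage hΓ.universallyMeasurableSet
  · rw [← hfπ]
    refine Measure.map_congr ?_
    have hfh : AEMeasurable (f h) volume :=
      (hf.comp_measurable (measurable_const (a := h) |>.prodMk measurable_id)).aemeasurable _
    have hprob := π.isProb n h
    have hae : ∀ᵐ a ∂π.μ n h, a ∈ Acts h.2 :=
      (prob_compl_eq_zero_iff₀ (hact h.2 _ hprob)).2 (π.feasible n h)
    rw [← hfπ] at hae
    filter_upwards [ae_of_ae_map hfh hae] with t ht using if_pos ht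
  · dsimp only
    split_ifs with ht
    · exact ht
    · exact hsΓ h.2

end Representation

section SimulatedLaw

variable {X A : Type*} [MeasurableSpace X] [MeasurableSpace A]

/-- The law of the simulated trajectory for fixed decision randomness `θ`. -/
def simLaw (f : ∀ n, Hist X A n → unitInterval → A) (G : X × A → unitInterval → X)
    (φ : unitInterval → X) (θ : ℕ → unitInterval) : Measure (Traj X A) :=
  cubeMeasure.map fun η => simTraj f G (φ (η 0)) θ η

variable [StandardBorelSpace X] [StandardBorelSpace A]
  {f : ∀ n, Hist X A n → unitInterval → A}
  (hf : ∀ n, UniversallyMeasurable (Function.uncurry (f n)))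
  {G : X × A → unitInterval → X} (hG : Measurable (Function.uncurry G))
  {φ : unitInterval → X} (hφ : Measurable φ)
include hf hG hφ

lemma aemeasurable_simTraj (θ : ℕ → unitInterval) :
    AEMeasurable (fun η => simTraj f G (φ (η 0)) θ η) cubeMeasure :=
  (universallyMeasurable_simTraj hf hG (Measurable.universallyMeasurable (by fun_prop))
    measurable_const measurable_id).aemeasurable _

lemma isProbabilityMeasure_simLaw (θ : ℕ → unitInterval) :
    IsProbabilityMeasure (simLaw f G φ θ) :=
  isProbabilityMeasure_map (aemeasurable_simTraj hf hG hφ θ)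

lemma simLaw_apply (θ : ℕ → unitInterval) {B : Set (Traj X A)} (hB : MeasurableSet B) :
    simLaw f G φ θ B =
      ∫⁻ η, B.indicator (fun _ => 1) (simTraj f G (φ (η 0)) θ η) ∂cubeMeasure := by
  have hm := aemeasurable_simTraj hf hG hφ θ
  rw [← lintegral_map' ((measurable_const.indicator hB).aemeasurable) hm]
  exact (lintegral_indicator_one hB).symm

lemma simLaw_trajHist_preimage (θ : ℕ → unitInterval) {n : ℕ} {B : Set (Hist X A n)}
    (hB : MeasurableSet B) :
    simLaw f G φ θ (trajHist n ⁻¹' B) =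
      ∫⁻ η, B.indicator (fun _ => 1) (simHist f G (φ (η 0)) θ η n) ∂cubeMeasure := by
  rw [simLaw_apply hf hG hφ θ (measurable_trajHist n hB)]
  refine lintegral_congr fun η => ?_
  rw [← trajHist_simTraj]
  rfl

/-- A law with the same finite-dimensional distributions as a randomized policy is the mixture
of the simulated laws over the decision randomness. -/
lemma apply_eq_lintegral_simLaw {q : Kernel (X × A) X} (hGq : ∀ xa, volume.map (G xa) = q xa)
    {p0 : Measure X} (hp0 : volume.map φ = p0)
    {ν : ∀ n, Hist X A n → Measure A} (hfν : ∀ n h, volume.map (f n h) = ν n h)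
    {p : Measure (Traj X A)} [IsProbabilityMeasure p]
    (hp : ∀ (n : ℕ) (B : Set (Hist X A n)), MeasurableSet B →
      p (trajHist n ⁻¹' B) = histInt p0 q ν n (B.indicator fun _ => 1))
    {B : Set (Traj X A)} (hB : MeasurableSet B) :
    p B = ∫⁻ θ, simLaw f G φ θ B ∂cubeMeasure := by
  let T := fun z : (ℕ → unitInterval) × (ℕ → unitInterval) => simTraj f G (φ (z.2 0)) z.1 z.2
  have hU : UniversallyMeasurable T :=
    universallyMeasurable_simTraj hf hG (Measurable.universallyMeasurable (by fun_prop))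
      measurable_fst measurable_snd
  have hm : AEMeasurable T (cubeMeasure.prod cubeMeasure) := hU.aemeasurable _
  have := isProbabilityMeasure_map hm
  have hmap : ∀ D : Set (Traj X A), MeasurableSet D →
      (cubeMeasure.prod cubeMeasure).map T D = ∫⁻ θ, simLaw f G φ θ D ∂cubeMeasure := by
    intro D hD
    have hind : Measurable (D.indicator fun _ => (1 : ℝ≥0∞)) := measurable_const.indicator hD
    simp_rw [simLaw_apply hf hG hφ _ hD]
    rw [← lintegral_prod (fun z => D.indicator (fun _ => (1 : ℝ≥0∞)) (T z))
      ((hind.comp_universallyMeasurable hU).aemeasurable _),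
      ← lintegral_map' hind.aemeasurable hm]
    exact (lintegral_indicator_one hD).symm
  rw [← hmap B hB]
  congr 1
  refine ext_of_trajHist fun n D hD => ?_
  rw [hp n D hD, hmap _ (measurable_trajHist n hD)]
  simp_rw [simLaw_trajHist_preimage hf hG hφ _ hD]
  exact (lintegral_simHist_map hf hG hφ hGq hp0 hfν n
    (measurable_const.indicator hD).universallyMeasurable).symm

end SimulatedLaw

lemma apply_eq_lintegral_of_nullMeasurableSet {Y Θ : Type*} [MeasurableSpace Y]
    [MeasurableSpace Θ] {μ : Measure Θ} {p : Measure Y} {κ : Θ → Measure Y}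
    (hp : ∀ B, MeasurableSet B → p B = ∫⁻ θ, κ θ B ∂μ) {E : Set Y}
    (hE : NullMeasurableSet E p) : p E = ∫⁻ θ, κ θ E ∂μ := by
  obtain ⟨B, hBE, hB, hBae⟩ := hE.exists_measurable_subset_ae_eq
  refine le_antisymm ?_ ?_
  · rw [← measure_congr hBae, hp B hB]
    exact lintegral_mono fun θ => measure_mono hBE
  · rw [← measure_toMeasurable E, hp _ (measurableSet_toMeasurable p E)]
    exact lintegral_mono fun θ => measure_mono (subset_toMeasurable p E)

section WeakTopology

variable {X A : Type*} [TopologicalSpace X] [PolishSpace X] [MeasurableSpace X] [BorelSpace X]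
  [TopologicalSpace A] [PolishSpace A] [MeasurableSpace A] [BorelSpace A]

lemma exists_measurable_map_eq_probabilityMeasure [Nonempty X] :
    ∃ Φ : ProbabilityMeasure X → unitInterval → X, Measurable (Function.uncurry Φ) ∧
      ∀ p0, volume.map (Φ p0) = p0.toMeasure := by
  let K : Kernel (ProbabilityMeasure X) X := ⟨fun p0 => p0.toMeasure,
    measurable_of_measurable_coe _ fun B hB => measurable_borel_apply hB⟩
  have : IsMarkovKernel K := ⟨fun p0 => p0.2⟩
  exact K.exists_measurable_map_eq_unitInterval

lemma universallyMeasurable_simLaw {f : ∀ n, Hist X A n → unitInterval → A}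
    (hf : ∀ n, UniversallyMeasurable (Function.uncurry (f n)))
    {G : X × A → unitInterval → X} (hG : Measurable (Function.uncurry G))
    {Φ : ProbabilityMeasure X → unitInterval → X} (hΦ : Measurable (Function.uncurry Φ))
    {R : ProbabilityMeasure X × (ℕ → unitInterval) → ProbabilityMeasure (Traj X A)}
    (hR : ∀ z, (R z).toMeasure = simLaw f G (Φ z.1) z.2) : UniversallyMeasurable R := by
  refine @measurable_borel_of_measurable_apply (Traj X A) _ _ _ _ _
    (universalSpace (ProbabilityMeasure X × (ℕ → unitInterval))) R fun U hU => ?_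
  have hind : Measurable (U.indicator fun _ => (1 : ℝ≥0∞)) :=
    measurable_const.indicator hU.measurableSet
  simp_rw [hR, simLaw_apply hf hG hΦ.of_uncurry_left _ hU.measurableSet]
  refine UniversallyMeasurable.lintegral_prod_right
    (f := fun w : (ProbabilityMeasure X × (ℕ → unitInterval)) × (ℕ → unitInterval) =>
      U.indicator (fun _ => (1 : ℝ≥0∞)) (simTraj f G (Φ w.1.1 (w.2 0)) w.1.2 w.2)) ?_ cubeMeasure
  refine hind.comp_universallyMeasurable (universallyMeasurable_simTraj hf hG
    (Measurable.universallyMeasurable ?_) (by fun_prop) measurable_snd)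
  exact hΦ.comp (Measurable.prodMk (by fun_prop) (by fun_prop))

end WeakTopology

/-- The nonrandomized policy given by decision functions with fixed randomness `θ`. -/
def Policy.ofDecision {X A : Type*} [MeasurableSpace X] [MeasurableSpace A] {Acts : X → Set A}
    (f : ∀ n, Hist X A n → unitInterval → A)
    (hf : ∀ n, UniversallyMeasurable (Function.uncurry (f n)))
    (hfA : ∀ n h t, f n h t ∈ Acts h.2) (θ : ℕ → unitInterval) : Policy Acts where
  μ n h := dirac (f n h (θ n))
  isProb _ _ := inferInstance
  umeas n B hB := by
    have hfθ : UniversallyMeasurable fun h : Hist X A n => f n h (θ n) :=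
      (hf n).comp_measurable (f := fun h => (h, θ n)) (by fun_prop)
    exact Measurable.comp_universallyMeasurable (g := fun a => dirac a B)
      ((measurable_coe hB).comp measurable_dirac) hfθ
  feasible n h := dirac_apply_of_mem (hfA n h (θ n))

/-- Theorem `thm-rep-nonrand`: every policy is a `λ̄`-mixture of a
universally measurable family of nonrandomized policies parametrized by `θ̄ ∈ [0,1]^∞`,
where `λ̄` is the countable product of Lebesgue measures on `[0,1]`; the family is
Markov (semi-Markov) if the policy is. -/
theorem statement3
    {X A : Type*} [TopologicalSpace X] [PolishSpace X] [MeasurableSpace X] [BorelSpace X]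
    [TopologicalSpace A] [PolishSpace A] [MeasurableSpace A] [BorelSpace A]
    (q : Kernel (X × A) X) [IsMarkovKernel q] (Acts : X → Set A)
    (hne : ∀ x, (Acts x).Nonempty)
    (hΓ : MeasureTheory.AnalyticSet {xa : X × A | xa.2 ∈ Acts xa.1})
    -- `lam` is the countable product of Lebesgue measures on `[0,1]`:
    (lam : Measure (ℕ → unitInterval)) (hlamP : IsProbabilityMeasure lam)
    (hlam : ∀ (n : ℕ) (B : Fin n → Set unitInterval), (∀ i, MeasurableSet (B i)) →
      lam {θ | ∀ i : Fin n, θ i.val ∈ B i} = ∏ i : Fin n, volume (Subtype.val '' B i))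
    (π : Policy Acts) :
    ∃ F : (ℕ → unitInterval) → Policy Acts,
      (∀ θ, (F θ).Nonrandomized) ∧
      ∃ R : ProbabilityMeasure X × (ℕ → unitInterval) → ProbabilityMeasure (Traj X A),
        -- (i) `(p₀, θ̄) ↦ ρ_{p₀}[f̄(θ̄)]` is universally measurable
        UniversallyMeasurable R ∧
        (∀ (p0 : ProbabilityMeasure X) (θ : ℕ → unitInterval),
          Induces q (F θ) p0.toMeasure (R (p0, θ)).toMeasure) ∧
        -- (ii) `P^π_{p₀}(E) = ∫ P^{f̄(θ̄)}_{p₀}(E) λ̄(dθ̄)` for universally measurable `E`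
        (∀ (p0 : ProbabilityMeasure X) (p : ProbabilityMeasure (Traj X A)),
          Induces q π p0.toMeasure p.toMeasure →
          ∀ E : Set (Traj X A), UniversallyMeasurableSet E →
            p.toMeasure E = ∫⁻ θ, (R (p0, θ)).toMeasure E ∂lam) ∧
        -- the family inherits the Markov / semi-Markov property
        (π.Markov → ∀ θ, (F θ).Markov) ∧
        (π.SemiMarkov → ∀ θ, (F θ).SemiMarkov) := by
  rcases isEmpty_or_nonempty X with hX | hX
  · have hH : ∀ n, IsEmpty (Hist X A n) := fun n => ⟨fun h => hX.false h.2⟩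
    have hP : IsEmpty (ProbabilityMeasure X) :=
      ⟨fun p0 => (nonempty_of_isProbabilityMeasure p0.toMeasure).elim hX.false⟩
    exact ⟨fun _ => π, fun _ n h => ((hH n).false h).elim, fun z => (hP.false z.1).elim,
      fun s _ => by rw [Set.eq_empty_of_isEmpty (_ ⁻¹' s)]; exact fun _ _ => .of_null (by simp),
      fun p0 => (hP.false p0).elim, fun p0 => (hP.false p0).elim, fun h _ => h, fun h _ => h⟩
  obtain ⟨x₀⟩ := id hX
  obtain ⟨a₀, -⟩ := hne x₀
  have hA : Nonempty A := ⟨a₀⟩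
  obtain rfl : lam = cubeMeasure := eq_infinitePi_volume hlam
  choose f₀ hf₀ hf₀π hf₀A using π.exists_representation hne hΓ
  obtain ⟨r, hr, hr2, hrπ, hrM, hrS⟩ := π.exists_reduction
  let f : ∀ n, Hist X A n → unitInterval → A := fun n h => f₀ n (r n h)
  have hf : ∀ n, UniversallyMeasurable (Function.uncurry (f n)) := fun n =>
    (hf₀ n).comp_measurable (((hr n).comp measurable_fst).prodMk measurable_snd)
  have hfπ : ∀ n h, volume.map (f n h) = π.μ n h := fun n h => (hf₀π n _).trans (hrπ n h)
  have hfA : ∀ n h t, f n h t ∈ Acts h.2 := fun n h t => hr2 n h ▸ hf₀A n (r n h) t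
  obtain ⟨G, hG, hGq⟩ := q.exists_measurable_map_eq_unitInterval
  obtain ⟨Φ, hΦ, hΦp⟩ := exists_measurable_map_eq_probabilityMeasure (X := X)
  have hΦm : ∀ p0, Measurable (Φ p0) := fun p0 => hΦ.of_uncurry_left
  refine ⟨Policy.ofDecision f hf hfA, fun θ n h => ⟨_, rfl⟩,
    fun z => ⟨simLaw f G (Φ z.1) z.2, isProbabilityMeasure_simLaw hf hG (hΦm _) _⟩,
    universallyMeasurable_simLaw hf hG hΦ fun _ => rfl, fun p0 θ n B hB => ?_,
    fun p0 p hp E hE => ?_, fun hM θ => ?_, fun hS θ => ?_⟩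
  · exact (simLaw_trajHist_preimage hf hG (hΦm p0) θ hB).trans
      (lintegral_simHist_dirac hf hG (hΦm p0) hGq (hΦp p0) θ n
        (measurable_const.indicator hB).universallyMeasurable)
  · exact apply_eq_lintegral_of_nullMeasurableSet (fun B hB =>
      apply_eq_lintegral_simLaw hf hG (hΦm p0) hGq (hΦp p0) hfπ hp hB) (hE _ p.2)
  · refine ⟨fun n x => dirac (f n (fun _ => (x₀, a₀), x) (θ n)), fun n h => ?_⟩
    have := hrM hM n h (fun _ => (x₀, a₀), h.2) rfl
    simp only [Policy.ofDecision, f, this]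
  · refine ⟨fun n x => dirac (f n (fun _ => (x.1, a₀), x.2) (θ n)), fun n h => ?_⟩
    have := hrS hS n h (fun _ => (firstState h, a₀), h.2) (by cases n <;> rfl) rfl
    simp only [Policy.ofDecision, f]
    rw [this]

end PaperStmt
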